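/- The Fresnel combinations F⁺ := Fc + Fs and F⁻ := Fc − Fs satisfy: F⁺(x) > F⁻(x) > 0 for 0 < x < 3π/4, and F⁺(x) > (1 + √2)·|F⁻(x)| for x ≥ 3π/4. -/

import Mathlib

open Real MeasureTheory Set
open scoped Classical

noncomputable section

/-- A window function `g ∈ 𝒲`: nonnegative, even, with support `(-2/3, 2/3)`,
and whose integer translates form a partition of unity. -/
structure IsWindow (g : ℝ → ℝ) : Prop where
  nonneg : ∀ x, 0 ≤ g x
  even_fun : ∀ x, g (-x) = g x
  supp_eq : Function.support g = Ioo (-(2/3) : ℝ) (2/3)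
  partition : ∀ x : ℝ, HasSum (fun z : ℤ => g (x + (z : ℝ))) 1

/-- `g ∈ 𝒲^q`: a window function that is `q`-times continuously differentiable. -/
def IsWindowQ (g : ℝ → ℝ) (q : ℕ) : Prop := IsWindow g ∧ ContDiff ℝ q g

/-- `g̃(x) = g(x/2) - g(x)`. -/
def gtilde (g : ℝ → ℝ) : ℝ → ℝ := fun x => g (x / 2) - g x

/-- Horizontal bivariate window `Ψ^{(h)}(x) = g̃(x₁) g(x₂)`. -/
def PsiH (g : ℝ → ℝ) : ℝ × ℝ → ℝ := fun x => gtilde g x.1 * g x.2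

/-- Vertical bivariate window `Ψ^{(v)}(x) = g(x₁) g̃(x₂)`. -/
def PsiV (g : ℝ → ℝ) : ℝ × ℝ → ℝ := fun x => g x.1 * gtilde g x.2

/-- `Ψ_{j,ℓ}^{(i)}(ξ) = Ψ^{(i)}((N_{j,ℓ}^{(i)})^{-T} ξ)`, where the inverse transpose of the
shear matrices has been written out explicitly.  `i = true` is the horizontal case `(h)`,
`i = false` the vertical case `(v)`. -/
def PsiJL (g : ℝ → ℝ) (i : Bool) (j : ℕ) (ℓ : ℤ) : ℝ × ℝ → ℝ := fun ξ =>
  if i then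
    PsiH g ((2:ℝ) ^ (-(j:ℝ)) * ξ.1,
            (2:ℝ) ^ (-(j:ℝ)/2) * ξ.2 - (ℓ:ℝ) * (2:ℝ) ^ (-(j:ℝ)) * ξ.1)
  else
    PsiV g ((2:ℝ) ^ (-(j:ℝ)/2) * ξ.1 - (ℓ:ℝ) * (2:ℝ) ^ (-(j:ℝ)) * ξ.2,
            (2:ℝ) ^ (-(j:ℝ)) * ξ.2)

/-- Discrete angles `θ_{j,ℓ}^{(h)} = arctan(ℓ 2^{-j/2})`,
`θ_{j,ℓ}^{(v)} = arccot(ℓ 2^{-j/2}) = π/2 - arctan(ℓ 2^{-j/2})`. -/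
def thetaJL (i : Bool) (j : ℕ) (ℓ : ℤ) : ℝ :=
  if i then arctan ((ℓ:ℝ) * (2:ℝ) ^ (-(j:ℝ)/2))
  else π/2 - arctan ((ℓ:ℝ) * (2:ℝ) ^ (-(j:ℝ)/2))

/-- The pattern `𝒫(N_{j,ℓ}^{(i)}) = (N_{j,ℓ}^{(i)})^{-1} ℤ² ∩ [-1/2,1/2)²`:
`y` belongs to the pattern iff `N_{j,ℓ}^{(i)} y ∈ ℤ²` and `y ∈ [-1/2,1/2)²`. -/
def pattern (i : Bool) (j : ℕ) (ℓ : ℤ) : Set (ℝ × ℝ) :=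
  {y : ℝ × ℝ |
    (∃ k : ℤ × ℤ,
      (if i then ((2:ℝ)^(j:ℝ) * y.1 + (ℓ:ℝ) * (2:ℝ)^((j:ℝ)/2) * y.2, (2:ℝ)^((j:ℝ)/2) * y.2)
       else ((2:ℝ)^((j:ℝ)/2) * y.1, (ℓ:ℝ) * (2:ℝ)^((j:ℝ)/2) * y.1 + (2:ℝ)^(j:ℝ) * y.2))
        = ((k.1 : ℝ), (k.2 : ℝ)))
    ∧ y.1 ∈ Ico (-(1/2) : ℝ) (1/2) ∧ y.2 ∈ Ico (-(1/2) : ℝ) (1/2)}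

/-- `ỹ = y - (2^{-j-1},0)ᵀ` in the horizontal case, `ỹ = y - (0,2^{-j-1})ᵀ` in the vertical one. -/
def ytilde (i : Bool) (j : ℕ) (y : ℝ × ℝ) : ℝ × ℝ :=
  if i then (y.1 - (2:ℝ) ^ (-(j:ℝ) - 1), y.2) else (y.1, y.2 - (2:ℝ) ^ (-(j:ℝ) - 1))

/-- The trigonometric polynomial shearlet
`ψ_{j,ℓ,y}^{(i)}(x) = ∑_{k∈ℤ²} Ψ_{j,ℓ}^{(i)}(k) e^{i k·(x - 2πỹ)}`. -/
def shearlet (g : ℝ → ℝ) (i : Bool) (j : ℕ) (ℓ : ℤ) (y : ℝ × ℝ) : ℝ × ℝ → ℂ := fun x =>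
  ∑' k : ℤ × ℤ, (PsiJL g i j ℓ ((k.1 : ℝ), (k.2 : ℝ)) : ℂ) *
    Complex.exp (Complex.I *
      (((k.1 : ℝ) * (x.1 - 2*π*(ytilde i j y).1)
        + (k.2 : ℝ) * (x.2 - 2*π*(ytilde i j y).2) : ℝ) : ℂ))

/-- `⟨f,h⟩₂ = (2π)^{-2} ∫_{𝕋²} f(x) conj(h(x)) dx`, with the torus realised as `[-π,π]²`. -/
def inner2 (f h : ℝ × ℝ → ℂ) : ℂ :=
  ((2*π)^2 : ℂ)⁻¹ * ∫ x in (Icc (-π) π ×ˢ Icc (-π) π : Set (ℝ × ℝ)), f x * (starRingEnd ℂ) (h x)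

/-- The `2π`-periodization `f^{2π} = ∑_{n∈ℤ²} f(· + 2πn)`. -/
def periodize (f : ℝ × ℝ → ℝ) : ℝ × ℝ → ℝ := fun x =>
  ∑' n : ℤ × ℤ, f (x.1 + 2*π*(n.1 : ℝ), x.2 + 2*π*(n.2 : ℝ))

/-- Euclidean norm `|x|₂` on `ℝ²`. -/
def nrm2 (x : ℝ × ℝ) : ℝ := Real.sqrt (x.1^2 + x.2^2)

/-- First partial derivative of a complex-valued function of two real variables. -/
def pd1 (f : ℝ × ℝ → ℂ) : ℝ × ℝ → ℂ := fun x => deriv (fun t => f (t, x.2)) x.1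

/-- Second partial derivative of a complex-valued function of two real variables. -/
def pd2 (f : ℝ × ℝ → ℂ) : ℝ × ℝ → ℂ := fun x => deriv (fun t => f (x.1, t)) x.2

/-- `∂^r = ∂^{r₁+r₂}/∂x₁^{r₁}∂x₂^{r₂}` (complex-valued). -/
def pd (r : ℕ × ℕ) (f : ℝ × ℝ → ℂ) : ℝ × ℝ → ℂ := pd1^[r.1] (pd2^[r.2] f)

/-- First partial derivative of a real-valued function of two real variables. -/
def pdR1 (f : ℝ × ℝ → ℝ) : ℝ × ℝ → ℝ := fun x => deriv (fun t => f (t, x.2)) x.1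

/-- Second partial derivative of a real-valued function of two real variables. -/
def pdR2 (f : ℝ × ℝ → ℝ) : ℝ × ℝ → ℝ := fun x => deriv (fun t => f (x.1, t)) x.2

/-- `∂^r = ∂^{r₁+r₂}/∂x₁^{r₁}∂x₂^{r₂}` (real-valued). -/
def pdR (r : ℕ × ℕ) (f : ℝ × ℝ → ℝ) : ℝ × ℝ → ℝ := pdR1^[r.1] (pdR2^[r.2] f)

/-- The Fourier transform `𝓕f(x) = (2π)^{-2} ∫_{ℝ²} f(ξ) e^{-iξ·x} dξ`. -/
def FT (f : ℝ × ℝ → ℂ) : ℝ × ℝ → ℂ := fun x =>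
  ((2*π)^2 : ℂ)⁻¹ * ∫ ξ : ℝ × ℝ, f ξ * Complex.exp (-(Complex.I) * ((ξ.1*x.1 + ξ.2*x.2 : ℝ) : ℂ))

/-- Rotation matrix `R_γ` acting on `ℝ²`. -/
def rotM (γ : ℝ) (x : ℝ × ℝ) : ℝ × ℝ :=
  (Real.cos γ * x.1 - Real.sin γ * x.2, Real.sin γ * x.1 + Real.cos γ * x.2)

/-- Transposed rotation matrix `R_γᵀ` acting on `ℝ²`. -/
def rotT (γ : ℝ) (x : ℝ × ℝ) : ℝ × ℝ :=
  (Real.cos γ * x.1 + Real.sin γ * x.2, -(Real.sin γ) * x.1 + Real.cos γ * x.2)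

/-- The standard edge fragment `ℰ_j(x) = f(x) φ(2^{j/2}x) χ_{{x₁ ≥ E(x₂)}}(x)`. -/
def edgeFragment (f φ : ℝ × ℝ → ℝ) (E : ℝ → ℝ) (j : ℕ) : ℝ × ℝ → ℝ := fun x =>
  f x * φ ((2:ℝ)^((j:ℝ)/2) * x.1, (2:ℝ)^((j:ℝ)/2) * x.2) * (if E x.2 ≤ x.1 then 1 else 0)

/-- The second-order differential operator `L = I + 2^j Δ`. -/
def Lop (j : ℕ) (f : ℝ × ℝ → ℂ) : ℝ × ℝ → ℂ := fun x =>
  f x + (Complex.ofReal ((2:ℝ)^(j:ℝ))) * (pd (2,0) f x + pd (0,2) f x)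

/-- The dyadic square `Q` indexed by `(n₁,n₂)` at scale `j`. -/
def dyadicSquare (j : ℕ) (n : ℕ × ℕ) : Set (ℝ × ℝ) :=
  Ico (2*π*(n.1:ℝ)*(2:ℝ)^(-(j:ℝ)/2) - π) (2*π*((n.1:ℝ)+1)*(2:ℝ)^(-(j:ℝ)/2) - π) ×ˢ
  Ico (2*π*(n.2:ℝ)*(2:ℝ)^(-(j:ℝ)/2) - π) (2*π*((n.2:ℝ)+1)*(2:ℝ)^(-(j:ℝ)/2) - π)

/-- The indices of the dyadic squares at scale `j` meeting `∂T` (the set `𝒬_j^1`). -/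
def Q1set (T : Set (ℝ × ℝ)) (j : ℕ) : Finset (ℕ × ℕ) :=
  (Finset.range (2^(j/2)) ×ˢ Finset.range (2^(j/2))).filter
    (fun n => (frontier T ∩ dyadicSquare j n).Nonempty)

/-- Fresnel integral `Fc(x) = ∫₀ˣ cos v/√v dv`. -/
def Fc (x : ℝ) : ℝ := ∫ v in (0:ℝ)..x, Real.cos v / Real.sqrt v

/-- Fresnel integral `Fs(x) = ∫₀ˣ sin v/√v dv`. -/
def Fs (x : ℝ) : ℝ := ∫ v in (0:ℝ)..x, Real.sin v / Real.sqrt v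

/-- `F⁺ = Fc + Fs`. -/
def Fp (x : ℝ) : ℝ := Fc x + Fs x

/-- `F⁻ = Fc - Fs`. -/
def Fm (x : ℝ) : ℝ := Fc x - Fs x

/-- `a(λ,p,A)` of the paper. -/
def aInt (g : ℝ → ℝ) (l p A : ℝ) : ℝ :=
  ∫ v in Ioi (0:ℝ),
    (g (2*Real.sqrt (A*l*v) + p*l) + g (2*Real.sqrt (A*l*v) - p*l)) * (Real.cos v / Real.sqrt v)

/-- `b(λ,p,A)` of the paper. -/
def bInt (g : ℝ → ℝ) (l p A : ℝ) : ℝ :=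
  ∫ v in Ioi (0:ℝ),
    (g (2*Real.sqrt (A*l*v) + p*l) + g (2*Real.sqrt (A*l*v) - p*l)) * (Real.sin v / Real.sqrt v)

/-- `P₁(D,p,A)` of the paper. -/
def P1 (g : ℝ → ℝ) (D p A : ℝ) : ℝ :=
  ∫ l in (1/3 : ℝ)..(4/3),
    gtilde g l * l⁻¹ *
      ((aInt g l p A + bInt g l p A) * Real.cos (D*l)
        + (aInt g l p A - bInt g l p A) * Real.sin (D*l))

/-- `P₂(D,p,A)` of the paper. -/
def P2 (g : ℝ → ℝ) (D p A : ℝ) : ℝ :=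
  ∫ l in (1/3 : ℝ)..(4/3),
    gtilde g l * l⁻¹ *
      ((aInt g l p A + bInt g l p A) * Real.sin (D*l)
        - (aInt g l p A - bInt g l p A) * Real.cos (D*l))

/-- The Gaussian-type Laplace transform `x ↦ ∫₀^∞ e^{-x u²} h(u) du`. -/
def gaussTransform (h : ℝ → ℝ) (x : ℝ) : ℝ := ∫ u in Ioi (0:ℝ), exp (-x * u ^ 2) * h u

theorem integrableOn_gaussTransform {h : ℝ → ℝ} (hc : Continuous h) (hb : ∀ u, |h u| ≤ 1)
    {x : ℝ} (hx : 0 < x) : IntegrableOn (fun u => exp (-x * u ^ 2) * h u) (Ioi 0) := by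
  refine ((integrable_exp_neg_mul_sq hx).integrableOn (s := Ioi 0)).mono'
    (by fun_prop) (ae_of_all _ fun u => ?_)
  rw [norm_mul, norm_eq_abs, norm_eq_abs, abs_of_pos (exp_pos _)]
  exact mul_le_of_le_one_right (exp_pos _).le (hb u)

theorem hasDerivAt_gaussTransform {h : ℝ → ℝ} (hc : Continuous h) (hb : ∀ u, |h u| ≤ 1)
    (hb2 : ∀ u, |u ^ 2 * h u| ≤ 1) {x : ℝ} (hx : 0 < x) :
    HasDerivAt (gaussTransform h) (-gaussTransform (fun u => u ^ 2 * h u) x) x := by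
  have key := hasDerivAt_integral_of_dominated_loc_of_deriv_le
    (μ := volume.restrict (Ioi (0:ℝ))) (F := fun y u => exp (-y * u ^ 2) * h u)
    (F' := fun y u => -(exp (-y * u ^ 2) * (u ^ 2 * h u))) (x₀ := x) (s := Ioi (x / 2))
    (bound := fun u => exp (-(x / 2) * u ^ 2)) (Ioi_mem_nhds (by linarith))
    (Filter.Eventually.of_forall fun y => by fun_prop)
    (integrableOn_gaussTransform hc hb hx) (by fun_prop)
    (ae_of_all _ fun u y hy => by
      rw [norm_neg, norm_mul, norm_eq_abs, norm_eq_abs, abs_of_pos (exp_pos _)]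
      refine (mul_le_of_le_one_right (exp_pos _).le (hb2 u)).trans (exp_le_exp.2 ?_)
      have : x / 2 < y := hy
      nlinarith [sq_nonneg u])
    ((integrable_exp_neg_mul_sq (half_pos hx)).integrableOn)
    (ae_of_all _ fun u y _ => by
      have h1 : HasDerivAt (fun y : ℝ => -y * u ^ 2) (-1 * u ^ 2) y :=
        (hasDerivAt_id y).neg.mul_const _
      convert! h1.exp.mul_const (h u) using 1
      ring)
  have := key.2
  rw [integral_neg] at this
  exact this

theorem continuousOn_gaussTransform {h : ℝ → ℝ} (hc : Continuous h)
    (hi : IntegrableOn h (Ioi 0)) : ContinuousOn (gaussTransform h) (Ici 0) := by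
  intro x _
  refine continuousWithinAt_of_dominated (bound := fun u => ‖h u‖)
    (Filter.Eventually.of_forall fun y => by fun_prop) ?_ hi.norm
    (ae_of_all _ fun u => Continuous.continuousWithinAt (by fun_prop))
  filter_upwards [self_mem_nhdsWithin] with y hy
  refine ae_of_all _ fun u => ?_
  rw [norm_mul, norm_eq_abs, abs_of_pos (exp_pos _)]
  refine mul_le_of_le_one_left (norm_nonneg _) (exp_le_one_iff.2 ?_)
  have : 0 ≤ y := hy
  nlinarith [sq_nonneg u]

theorem gaussTransform_pos {h : ℝ → ℝ} (hc : Continuous h) (hb : ∀ u, |h u| ≤ 1)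
    (hpos : ∀ u, 0 < u → 0 < h u) {x : ℝ} (hx : 0 < x) : 0 < gaussTransform h x := by
  have hp : ∀ u ∈ Ioi (0:ℝ), 0 < exp (-x * u ^ 2) * h u := fun u hu =>
    mul_pos (exp_pos _) (hpos u hu)
  refine (setIntegral_pos_iff_support_of_nonneg_ae
    ((ae_restrict_mem measurableSet_Ioi).mono fun u hu => (hp u hu).le)
    (integrableOn_gaussTransform hc hb hx)).2 ?_
  rw [inter_eq_right.2 fun u hu => Function.mem_support.2 (hp u hu).ne']
  simp

/-- The density of the in-phase part of the Fresnel tail. -/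
def tailCosDensity (u : ℝ) : ℝ := u ^ 2 / (1 + u ^ 4)

/-- The density of the quadrature part of the Fresnel tail. -/
def tailSinDensity (u : ℝ) : ℝ := 1 / (1 + u ^ 4)

theorem continuous_tailCosDensity : Continuous tailCosDensity :=
  Continuous.div (by fun_prop) (by fun_prop) fun u => by positivity

theorem continuous_tailSinDensity : Continuous tailSinDensity :=
  Continuous.div (by fun_prop) (by fun_prop) fun u => by positivity

theorem abs_tailCosDensity_le (u : ℝ) : |tailCosDensity u| ≤ 1 := by
  rw [tailCosDensity, abs_of_nonneg (by positivity), div_le_one (by positivity)]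
  nlinarith [sq_nonneg (u ^ 2 - 1)]

theorem abs_tailSinDensity_le (u : ℝ) : |tailSinDensity u| ≤ 1 := by
  rw [tailSinDensity, abs_of_nonneg (by positivity), div_le_one (by positivity)]
  nlinarith [sq_nonneg (u ^ 2)]

theorem sq_mul_tailSinDensity (u : ℝ) : u ^ 2 * tailSinDensity u = tailCosDensity u := by
  rw [tailSinDensity, tailCosDensity, mul_one_div]

theorem sq_mul_tailCosDensity (u : ℝ) : u ^ 2 * tailCosDensity u = 1 - tailSinDensity u := by
  have : (1 + u ^ 4 : ℝ) ≠ 0 := by positivity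
  rw [tailSinDensity, tailCosDensity]
  field_simp
  ring

theorem abs_sq_mul_tailCosDensity_le (u : ℝ) : |u ^ 2 * tailCosDensity u| ≤ 1 := by
  have h0 : 0 ≤ tailSinDensity u := by unfold tailSinDensity; positivity
  rw [abs_of_nonneg (by unfold tailCosDensity; positivity), sq_mul_tailCosDensity]
  linarith

theorem integrableOn_tailCosDensity : IntegrableOn tailCosDensity (Ioi 0) := by
  refine ((integrable_inv_one_add_sq.const_mul 2).integrableOn (s := Ioi 0)).mono'
    continuous_tailCosDensity.aestronglyMeasurable (ae_of_all _ fun u => ?_)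
  rw [tailCosDensity, norm_of_nonneg (by positivity), ← div_eq_mul_inv,
    div_le_div_iff₀ (by positivity) (by positivity)]
  nlinarith [sq_nonneg (u ^ 2 - 1), sq_nonneg (u ^ 2), sq_nonneg u]

theorem integrableOn_tailSinDensity : IntegrableOn tailSinDensity (Ioi 0) := by
  refine ((integrable_inv_one_add_sq.const_mul 2).integrableOn (s := Ioi 0)).mono'
    continuous_tailSinDensity.aestronglyMeasurable (ae_of_all _ fun u => ?_)
  rw [tailSinDensity, norm_of_nonneg (by positivity), ← div_eq_mul_inv,
    div_le_div_iff₀ (by positivity) (by positivity)]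
  nlinarith [sq_nonneg (u ^ 2 - 1), sq_nonneg (u ^ 2), sq_nonneg u]

theorem integral_tailCosDensity_eq_integral_tailSinDensity :
    ∫ u in Ioi (0:ℝ), tailCosDensity u = ∫ u in Ioi (0:ℝ), tailSinDensity u := by
  rw [← integral_comp_rpow_Ioi tailSinDensity (p := -1) (by norm_num)]
  refine setIntegral_congr_fun measurableSet_Ioi fun u hu => ?_
  have hu : 0 < u := hu
  have h2 : u ^ (-1 - 1 : ℝ) = (u ^ 2)⁻¹ := by
    rw [show (-1 - 1 : ℝ) = -((2 : ℕ) : ℝ) by norm_num, rpow_neg hu.le, rpow_natCast]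
  simp only [tailCosDensity, tailSinDensity, h2, rpow_neg_one, smul_eq_mul, abs_neg, abs_one]
  field_simp
  ring

theorem integral_tailCosDensity_add_integral_tailSinDensity :
    (∫ u in Ioi (0:ℝ), tailCosDensity u) + ∫ u in Ioi (0:ℝ), tailSinDensity u = π / √2 := by
  rw [← integral_add integrableOn_tailCosDensity integrableOn_tailSinDensity]
  have hs : √2 * √2 = (2:ℝ) := mul_self_sqrt (by norm_num)
  have hs0 : 0 < √(2:ℝ) := by positivity
  have hlin (c : ℝ) : Filter.Tendsto (fun u : ℝ => √2 * u + c) Filter.atTop Filter.atTop :=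
    Filter.tendsto_atTop_add_const_right _ _ (Filter.tendsto_id.const_mul_atTop hs0)
  have harc (c : ℝ) : Filter.Tendsto (fun u : ℝ => arctan (√2 * u + c)) Filter.atTop
      (nhds (π / 2)) :=
    (tendsto_nhds_of_tendsto_nhdsWithin tendsto_arctan_atTop).comp (hlin c)
  have hder (c u : ℝ) : HasDerivAt (fun u : ℝ => arctan (√2 * u + c))
      (1 / (1 + (√2 * u + c) ^ 2) * √2) u := by
    have : HasDerivAt (fun u : ℝ => √2 * u + c) √2 u := by
      simpa using ((hasDerivAt_id u).const_mul √2).add_const c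
    exact this.arctan
  rw [integral_Ioi_of_hasDerivAt_of_tendsto'
    (f := fun u => (arctan (√2 * u + 1) + arctan (√2 * u + -1)) / √2)
    (f' := fun u => tailCosDensity u + tailSinDensity u)
    (m := (π / 2 + π / 2) / √2) (fun u _ => ?_)
    (integrableOn_tailCosDensity.add integrableOn_tailSinDensity)
    (((harc 1).add (harc (-1))).div_const _)]
  · simp [arctan_neg]
  · convert! ((hder 1 u).add (hder (-1) u)).div_const √2 using 1
    have h1 : 1 + (√2 * u + 1) ^ 2 = 2 * (u ^ 2 + √2 * u + 1) := by linear_combination u ^ 2 * hs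
    have h2 : 1 + (√2 * u + -1) ^ 2 = 2 * (u ^ 2 - √2 * u + 1) := by
      linear_combination u ^ 2 * hs
    have p1 : u ^ 2 + √2 * u + 1 ≠ 0 := by
      have : 0 < 1 + (√2 * u + 1) ^ 2 := by positivity
      linarith
    have p2 : u ^ 2 - √2 * u + 1 ≠ 0 := by
      have : 0 < 1 + (√2 * u + -1) ^ 2 := by positivity
      linarith
    have h3 : 1 + u ^ 4 = (u ^ 2 + √2 * u + 1) * (u ^ 2 - √2 * u + 1) := by
      linear_combination u ^ 2 * hs
    rw [tailCosDensity, tailSinDensity, h1, h2, h3]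
    generalize hA : u ^ 2 + √2 * u + 1 = A at p1
    generalize hB : u ^ 2 - √2 * u + 1 = B at p2
    rw [show u ^ 2 = (A + B) / 2 - 1 by linarith]
    field_simp
    ring

/-- `p(x) = (2/√π) ∫₀^∞ e^{-xu²} u²/(1+u⁴) du`, so that
`∫ₓ^∞ e^{iv}/√v dv = e^{ix} (p(x) + i q(x))` with `q = fresnelQ`. -/
def fresnelP (x : ℝ) : ℝ := 2 / √π * gaussTransform tailCosDensity x

/-- `q(x) = (2/√π) ∫₀^∞ e^{-xu²}/(1+u⁴) du`. -/
def fresnelQ (x : ℝ) : ℝ := 2 / √π * gaussTransform tailSinDensity x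

theorem fresnelP_pos {x : ℝ} (hx : 0 < x) : 0 < fresnelP x :=
  mul_pos (by positivity) (gaussTransform_pos continuous_tailCosDensity abs_tailCosDensity_le
    (fun u hu => by unfold tailCosDensity; positivity) hx)

theorem fresnelQ_pos {x : ℝ} (hx : 0 < x) : 0 < fresnelQ x :=
  mul_pos (by positivity) (gaussTransform_pos continuous_tailSinDensity abs_tailSinDensity_le
    (fun u hu => by unfold tailSinDensity; positivity) hx)

theorem fresnelP_zero : fresnelP 0 = √π / √2 := by
  have h1 := integral_tailCosDensity_eq_integral_tailSinDensity
  have h2 := integral_tailCosDensity_add_integral_tailSinDensity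
  have h3 : gaussTransform tailCosDensity 0 = π / √2 / 2 := by
    simp only [gaussTransform, neg_zero, zero_mul, exp_zero, one_mul]
    linarith
  have h4 : √π * √π = π := mul_self_sqrt pi_pos.le
  rw [fresnelP, h3]
  field_simp
  linarith

theorem fresnelQ_zero : fresnelQ 0 = √π / √2 := by
  rw [← fresnelP_zero, fresnelP, fresnelQ]
  simp [gaussTransform, integral_tailCosDensity_eq_integral_tailSinDensity]

theorem continuousOn_fresnelP : ContinuousOn fresnelP (Ici 0) :=
  (continuousOn_gaussTransform continuous_tailCosDensity integrableOn_tailCosDensity).const_mul _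

theorem continuousOn_fresnelQ : ContinuousOn fresnelQ (Ici 0) :=
  (continuousOn_gaussTransform continuous_tailSinDensity integrableOn_tailSinDensity).const_mul _

theorem two_div_sqrt_pi_mul_integral_gaussian {x : ℝ} (hx : 0 < x) :
    2 / √π * ∫ u in Ioi (0:ℝ), exp (-x * u ^ 2) = 1 / √x := by
  rw [integral_gaussian_Ioi, sqrt_div pi_pos.le]
  have : 0 < √π := by positivity
  have : 0 < √x := by positivity
  field_simp

theorem hasDerivAt_fresnelP {x : ℝ} (hx : 0 < x) :
    HasDerivAt fresnelP (fresnelQ x - 1 / √x) x := by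
  convert! (hasDerivAt_gaussTransform continuous_tailCosDensity abs_tailCosDensity_le
    abs_sq_mul_tailCosDensity_le hx).const_mul (2 / √π) using 1
  rw [← two_div_sqrt_pi_mul_integral_gaussian hx, fresnelQ]
  simp only [gaussTransform, sq_mul_tailCosDensity, mul_sub, mul_one]
  rw [integral_sub (integrable_exp_neg_mul_sq hx).integrableOn
    (integrableOn_gaussTransform continuous_tailSinDensity abs_tailSinDensity_le hx)]
  ring

theorem hasDerivAt_fresnelQ {x : ℝ} (hx : 0 < x) : HasDerivAt fresnelQ (-fresnelP x) x := by
  convert! (hasDerivAt_gaussTransform continuous_tailSinDensity abs_tailSinDensity_le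
    (fun u => by rw [sq_mul_tailSinDensity]; exact abs_tailCosDensity_le u) hx).const_mul
    (2 / √π) using 1
  simp only [sq_mul_tailSinDensity, fresnelP]
  ring

/-- The modulus bound `|p(x) + i q(x)| ≤ 1/√x`, tested against a vector `(a, b)`. -/
theorem fresnelP_fresnelQ_le {a b r x : ℝ} (hr : 0 ≤ r) (hab : a ^ 2 + b ^ 2 ≤ r ^ 2)
    (hx : 0 < x) : a * fresnelP x + b * fresnelQ x ≤ r * (1 / √x) := by
  have hP := integrableOn_gaussTransform continuous_tailCosDensity abs_tailCosDensity_le hx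
  have hQ := integrableOn_gaussTransform continuous_tailSinDensity abs_tailSinDensity_le hx
  have key : a * gaussTransform tailCosDensity x + b * gaussTransform tailSinDensity x
      ≤ r * ∫ u in Ioi (0:ℝ), exp (-x * u ^ 2) := by
    simp only [gaussTransform]
    rw [← integral_const_mul, ← integral_const_mul, ← integral_const_mul,
      ← integral_add (hP.const_mul a) (hQ.const_mul b)]
    refine integral_mono ((hP.const_mul a).add (hQ.const_mul b))
      ((integrable_exp_neg_mul_sq hx).integrableOn.const_mul r) fun u => ?_
    have h1 : a * u ^ 2 + b ≤ r * (1 + u ^ 4) := by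
      refine abs_le_of_sq_le_sq' ?_ (by positivity) |>.2
      have : (a * u ^ 2 + b) ^ 2 ≤ (a ^ 2 + b ^ 2) * (1 + u ^ 4) := by
        nlinarith [sq_nonneg (a - b * u ^ 2)]
      have h3 : (a ^ 2 + b ^ 2) * (1 + u ^ 4) ≤ r ^ 2 * (1 + u ^ 4) := by gcongr
      have h4 : r ^ 2 * (1 + u ^ 4) ≤ r ^ 2 * (1 + u ^ 4) ^ 2 := by
        have : (0:ℝ) ≤ u ^ 4 := by positivity
        gcongr
        nlinarith
      linarith [mul_pow r (1 + u ^ 4) 2]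
    have h2 : a * tailCosDensity u + b * tailSinDensity u ≤ r := by
      rw [tailCosDensity, tailSinDensity, ← mul_div_assoc, ← mul_div_assoc, ← add_div, mul_one,
        div_le_iff₀ (by positivity)]
      exact h1
    have := mul_le_mul_of_nonneg_left h2 (exp_pos (-x * u ^ 2)).le
    simp only []
    linarith
  have := mul_le_mul_of_nonneg_left key (show (0:ℝ) ≤ 2 / √π by positivity)
  rw [← two_div_sqrt_pi_mul_integral_gaussian hx, fresnelP, fresnelQ]
  linarith

theorem intervalIntegrable_div_sqrt {f : ℝ → ℝ} (hf : Continuous f) (hb : ∀ v, |f v| ≤ 1)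
    {x : ℝ} (hx : 0 ≤ x) : IntervalIntegrable (fun v => f v / √v) volume 0 x := by
  have h := intervalIntegral.intervalIntegrable_rpow' (a := 0) (b := x)
    (show (-1:ℝ) < -(1 / 2) by norm_num)
  refine h.mono_fun (Measurable.aestronglyMeasurable (by fun_prop)) ?_
  filter_upwards [ae_restrict_mem measurableSet_uIoc] with v hv
  rw [uIoc_of_le hx] at hv
  rw [rpow_neg hv.1.le, ← sqrt_eq_rpow, norm_div, norm_inv, ← one_div]
  gcongr
  exact hb v

theorem hasDerivAt_integral_div_sqrt {f : ℝ → ℝ} (hf : Continuous f) (hb : ∀ v, |f v| ≤ 1)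
    {x : ℝ} (hx : 0 < x) : HasDerivAt (fun y => ∫ v in (0:ℝ)..y, f v / √v) (f x / √x) x :=
  intervalIntegral.integral_hasDerivAt_right (intervalIntegrable_div_sqrt hf hb hx.le)
    (Measurable.stronglyMeasurable (by fun_prop)).stronglyMeasurableAtFilter
    (hf.continuousAt.div continuous_sqrt.continuousAt (sqrt_pos.2 hx).ne')

theorem continuousOn_integral_div_sqrt {f : ℝ → ℝ} (hf : Continuous f) (hb : ∀ v, |f v| ≤ 1)
    {x : ℝ} (hx : 0 ≤ x) : ContinuousOn (fun y => ∫ v in (0:ℝ)..y, f v / √v) (Icc 0 x) := by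
  rw [← uIcc_of_le hx]
  exact intervalIntegral.continuousOn_primitive_interval'
    (intervalIntegrable_div_sqrt hf hb hx) left_mem_uIcc

theorem eq_of_hasDerivAt_zero {f : ℝ → ℝ} {x : ℝ} (hx : 0 < x) (hc : ContinuousOn f (Icc 0 x))
    (hd : ∀ y ∈ Ioo 0 x, HasDerivAt f 0 y) : f x = f 0 := by
  obtain ⟨c, -, h⟩ := exists_hasDerivAt_eq_slope f (fun _ => 0) hx hc hd
  rw [eq_comm, div_eq_zero_iff] at h
  rcases h with h | h <;> linarith

theorem Fc_eq {x : ℝ} (hx : 0 < x) :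
    Fc x = √π / √2 - (cos x * fresnelP x - sin x * fresnelQ x) := by
  have hsub : Icc 0 x ⊆ Ici (0:ℝ) := fun y hy => hy.1
  have h := eq_of_hasDerivAt_zero
    (f := fun y => Fc y + (cos y * fresnelP y - sin y * fresnelQ y)) hx
    ((continuousOn_integral_div_sqrt continuous_cos abs_cos_le_one hx.le).add
      ((continuous_cos.continuousOn.mul (continuousOn_fresnelP.mono hsub)).sub
        (continuous_sin.continuousOn.mul (continuousOn_fresnelQ.mono hsub))))
    (fun y hy => by
      convert! (hasDerivAt_integral_div_sqrt continuous_cos abs_cos_le_one hy.1).add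
        (((hasDerivAt_cos y).mul (hasDerivAt_fresnelP hy.1)).sub
          ((hasDerivAt_sin y).mul (hasDerivAt_fresnelQ hy.1))) using 1
      ring)
  simp only [cos_zero, sin_zero, fresnelP_zero] at h
  have h0 : Fc 0 = 0 := intervalIntegral.integral_same
  linarith

theorem Fs_eq {x : ℝ} (hx : 0 < x) :
    Fs x = √π / √2 - (sin x * fresnelP x + cos x * fresnelQ x) := by
  have hsub : Icc 0 x ⊆ Ici (0:ℝ) := fun y hy => hy.1
  have h := eq_of_hasDerivAt_zero
    (f := fun y => Fs y + (sin y * fresnelP y + cos y * fresnelQ y)) hx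
    ((continuousOn_integral_div_sqrt continuous_sin abs_sin_le_one hx.le).add
      ((continuous_sin.continuousOn.mul (continuousOn_fresnelP.mono hsub)).add
        (continuous_cos.continuousOn.mul (continuousOn_fresnelQ.mono hsub))))
    (fun y hy => by
      convert! (hasDerivAt_integral_div_sqrt continuous_sin abs_sin_le_one hy.1).add
        (((hasDerivAt_sin y).mul (hasDerivAt_fresnelP hy.1)).add
          ((hasDerivAt_cos y).mul (hasDerivAt_fresnelQ hy.1))) using 1
      ring)
  simp only [cos_zero, sin_zero, fresnelQ_zero] at h
  have h0 : Fs 0 = 0 := intervalIntegral.integral_same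
  linarith

theorem Fs_pos {x : ℝ} (hx : 0 < x) (hxπ : x < π) : 0 < Fs x :=
  intervalIntegral.intervalIntegral_pos_of_pos_on
    (intervalIntegrable_div_sqrt continuous_sin abs_sin_le_one hx.le)
    (fun _ hv => div_pos (sin_pos_of_pos_of_lt_pi hv.1 (hv.2.trans hxπ)) (sqrt_pos.2 hv.1)) hx

theorem sqrt_two_mul_cos_add_pi_div_four (v : ℝ) : √2 * cos (v + π / 4) = cos v - sin v := by
  have hs : √2 * √2 = (2:ℝ) := mul_self_sqrt (by norm_num)
  rw [cos_add, cos_pi_div_four, sin_pi_div_four]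
  linear_combination (cos v - sin v) / 2 * hs

theorem sqrt_two_mul_sin_add_pi_div_four (v : ℝ) : √2 * sin (v + π / 4) = cos v + sin v := by
  have hs : √2 * √2 = (2:ℝ) := mul_self_sqrt (by norm_num)
  rw [sin_add, cos_pi_div_four, sin_pi_div_four]
  linear_combination (cos v + sin v) / 2 * hs

theorem Fm_pos_of_le_pi_div_four {x : ℝ} (hx : 0 < x) (hx4 : x ≤ π / 4) : 0 < Fm x := by
  have hc := intervalIntegrable_div_sqrt continuous_cos abs_cos_le_one hx.le
  have hs := intervalIntegrable_div_sqrt continuous_sin abs_sin_le_one hx.le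
  rw [Fm, Fc, Fs, ← intervalIntegral.integral_sub hc hs]
  refine intervalIntegral.intervalIntegral_pos_of_pos_on (hc.sub hs) (fun v hv => ?_) hx
  rw [← sub_div, ← sqrt_two_mul_cos_add_pi_div_four]
  have : 0 < cos (v + π / 4) :=
    cos_pos_of_mem_Ioo ⟨by linarith [hv.1, pi_pos], by linarith [hv.2]⟩
  have := sqrt_pos.2 hv.1
  positivity

theorem Fm_eq {x : ℝ} (hx : 0 < x) :
    Fm x = √2 * (sin (x + π / 4) * fresnelQ x - cos (x + π / 4) * fresnelP x) := by
  rw [Fm, Fc_eq hx, Fs_eq hx]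
  linear_combination fresnelP x * sqrt_two_mul_cos_add_pi_div_four x
    - fresnelQ x * sqrt_two_mul_sin_add_pi_div_four x

theorem Fm_pos_of_pi_div_four_lt {x : ℝ} (hx : π / 4 < x) (hx4 : x < 3 * π / 4) :
    0 < Fm x := by
  have hx0 : 0 < x := by linarith [pi_pos]
  have hsin : 0 < sin (x + π / 4) := sin_pos_of_pos_of_lt_pi (by linarith) (by linarith)
  have hcos : cos (x + π / 4) < 0 := cos_neg_of_pi_div_two_lt_of_lt (by linarith) (by linarith)
  rw [Fm_eq hx0]
  have := mul_pos hsin (fresnelQ_pos hx0)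
  have := mul_neg_of_neg_of_pos hcos (fresnelP_pos hx0)
  exact mul_pos (by positivity) (by linarith)

theorem mul_one_div_sqrt_lt_sqrt_pi {x : ℝ} (hx : 3 * π / 4 ≤ x) :
    √(4 + 2 * √2) * (1 / √x) < √π := by
  have hx0 : 0 < x := by linarith [pi_pos]
  have hs : √2 < (1.415:ℝ) := by rw [sqrt_lt' (by norm_num)]; norm_num
  rw [mul_one_div, div_lt_iff₀ (sqrt_pos.2 hx0), ← sqrt_mul pi_pos.le]
  refine sqrt_lt_sqrt (by positivity) ?_
  nlinarith [pi_gt_d2]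

theorem Fp_gt_of_three_pi_div_four_le {x : ℝ} (hx : 3 * π / 4 ≤ x) :
    (1 + √2) * |Fm x| < Fp x := by
  have hx0 : 0 < x := by linarith [pi_pos]
  have hs : √2 * √2 = (2:ℝ) := mul_self_sqrt (by norm_num)
  have hr : √(4 + 2 * √2) ^ 2 = 4 + 2 * √2 := sq_sqrt (by positivity)
  have hK : √π / √2 * √2 = √π := div_mul_cancel₀ _ (by positivity)
  have hcs := sin_sq_add_cos_sq x
  have hlt := mul_one_div_sqrt_lt_sqrt_pi hx
  have h1 : 0 < (1 + √2) * Fs x - Fc x := by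
    have := fresnelP_fresnelQ_le (a := (1 + √2) * sin x - cos x)
      (b := (1 + √2) * cos x + sin x) (sqrt_nonneg (4 + 2 * √2))
      (by rw [hr]; apply le_of_eq; linear_combination (4 + 2 * √2) * hcs +
            (sin x ^ 2 + cos x ^ 2) * hs) hx0
    rw [Fc_eq hx0, Fs_eq hx0]
    linarith
  have h2 : 0 < (1 + √2) * Fc x - Fs x := by
    have := fresnelP_fresnelQ_le (a := (1 + √2) * cos x - sin x)
      (b := -(1 + √2) * sin x - cos x) (sqrt_nonneg (4 + 2 * √2))
      (by rw [hr]; apply le_of_eq; linear_combination (4 + 2 * √2) * hcs +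
            (sin x ^ 2 + cos x ^ 2) * hs) hx0
    rw [Fc_eq hx0, Fs_eq hx0]
    linarith
  have hs0 : 0 < √(2:ℝ) := by positivity
  have e1 : Fp x - (1 + √2) * Fm x = √2 * ((1 + √2) * Fs x - Fc x) := by
    rw [Fp, Fm]; linear_combination -Fs x * hs
  have e2 : Fp x + (1 + √2) * Fm x = √2 * ((1 + √2) * Fc x - Fs x) := by
    rw [Fp, Fm]; linear_combination -Fc x * hs
  have := mul_pos hs0 h1
  have := mul_pos hs0 h2
  rcases abs_cases (Fm x) with ⟨h, -⟩ | ⟨h, -⟩ <;> rw [h] <;> linarith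

/-- The Fresnel combinations `F⁺ = Fc + Fs` and `F⁻ = Fc − Fs` satisfy
`F⁺(x) > F⁻(x) > 0` for `0 < x < 3π/4` and `F⁺(x) > (1+√2)|F⁻(x)|` for `x ≥ 3π/4`. -/
theorem fresnel_combinations :
    (∀ x : ℝ, 0 < x → x < 3*π/4 → Fp x > Fm x ∧ Fm x > 0) ∧
    (∀ x : ℝ, 3*π/4 ≤ x → Fp x > (1 + Real.sqrt 2) * |Fm x|) := by
  refine ⟨fun x hx hx4 => ⟨?_, ?_⟩, fun x hx => Fp_gt_of_three_pi_div_four_le hx⟩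
  · have := Fs_pos hx (by linarith [pi_pos])
    rw [Fp, Fm]
    linarith
  · rcases le_or_gt x (π / 4) with h | h
    · exact Fm_pos_of_le_pi_div_four hx h
    · exact Fm_pos_of_pi_div_four_lt h hx4
end
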